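/- Let n, k ∈ ℕ with 4 ≤ k ≤ n−2 and let 𝒫 = (P,w) be an internal-nonzero-weighted essential pseudostar of kind (n,k) with leaf set [n]. For distinct leaves i, j, l, m, the Buneman index ⟨i,j | l,m⟩ holds if and only if at least one of the following holds: (a) {i,j} and {l,m} are complete cherries in P; (b) there exists a (k−2)-subset S of [n]−{i,j,l,m} with D_{{i,j}∪S}(𝒫) + D_{{l,m}∪S}(𝒫) ≠ D_{{i,l}∪S}(𝒫) + D_{{j,m}∪S}(𝒫), and there exists a (k−2)-subset R of [n]−{i,j,l,m} with D_{{i,j}∪R}(𝒫) + D_{{l,m}∪R}(𝒫) ≠ D_{{i,m}∪R}(𝒫) + D_{{j,l}∪R}(𝒫). -/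

import Mathlib

/-- A weighted finite tree with leaf set labelled by `Fin n`:
a finite vertex type `V`, a tree `G` on `V`, an injective labelling `leaf` of the
degree-one vertices by `Fin n` (every vertex of degree one is a labelled leaf),
and a weight function `w` on edges (zero off the edge set). -/
structure WTree (n : ℕ) where
  V : Type
  fintypeV : Fintype V
  G : SimpleGraph V
  isTree : G.IsTree
  leaf : Fin n → V
  leafInj : Function.Injective leaf
  leafSpec : ∀ v : V, (G.neighborSet v).ncard = 1 ↔ v ∈ Set.range leaf
  w : Sym2 V → ℝ
  wSupport : ∀ e, e ∉ G.edgeSet → w e = 0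

namespace WTree

variable {n : ℕ}

/-- The degree of a vertex. -/
noncomputable def deg (T : WTree n) (v : T.V) : ℕ := (T.G.neighborSet v).ncard

/-- A node is a vertex of degree `> 2`. -/
def IsNode (T : WTree n) (v : T.V) : Prop := 2 < T.deg v

/-- A tree is essential if it has no vertices of degree `2`. -/
def Essential (T : WTree n) : Prop := ∀ v : T.V, T.deg v ≠ 2

/-- The set of edges lying on the path between two vertices. -/
def pathEdges (T : WTree n) (u v : T.V) : Set (Sym2 T.V) :=
  {e | ∃ p : T.G.Walk u v, p.IsPath ∧ e ∈ p.edges}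

/-- The edge set of the minimal subtree containing the leaves in `S`. -/
def subtreeEdges (T : WTree n) (S : Set (Fin n)) : Set (Sym2 T.V) :=
  {e | ∃ i ∈ S, ∃ j ∈ S, e ∈ T.pathEdges (T.leaf i) (T.leaf j)}

/-- `D_I(T)`: the weight of the minimal subtree of `T` containing the leaves in `I`. -/
noncomputable def D (T : WTree n) (I : Finset (Fin n)) : ℝ :=
  ∑ᶠ e ∈ T.subtreeEdges ↑I, T.w e

/-- The total weight of the tree. -/
noncomputable def Dtot (T : WTree n) : ℝ := ∑ᶠ e ∈ T.G.edgeSet, T.w e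

/-- An edge is a twig edge if it lies on the path from some leaf to the nearest node. -/
def IsTwigEdge (T : WTree n) (e : Sym2 T.V) : Prop :=
  ∃ (i : Fin n) (v : T.V), T.IsNode v ∧
    ∃ p : T.G.Walk (T.leaf i) v, p.IsPath ∧
      (∀ u ∈ p.support, T.IsNode u → u = v) ∧ e ∈ p.edges

/-- Internal-nonzero-weighted: every internal (non-twig) edge has nonzero weight. -/
def InternalNonzero (T : WTree n) : Prop :=
  ∀ e ∈ T.G.edgeSet, ¬ T.IsTwigEdge e → T.w e ≠ 0

/-- Positive-weighted: all edge weights are positive. -/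
def PositiveWeighted (T : WTree n) : Prop := ∀ e ∈ T.G.edgeSet, 0 < T.w e

/-- The leaves lying on the side of vertex `a` after removing the edge `e`. -/
def sideLeaves (T : WTree n) (e : Sym2 T.V) (a : T.V) : Set (Fin n) :=
  {i | e ∉ T.pathEdges (T.leaf i) a}

/-- A pseudostar of kind `(n, k)`: every edge divides the leaf set into two parts,
at least one of which has cardinality `≥ k`. -/
def IsPseudostar (T : WTree n) (k : ℕ) : Prop :=
  ∀ a b : T.V, T.G.Adj a b →
    k ≤ (T.sideLeaves s(a, b) a).ncard ∨ k ≤ (T.sideLeaves s(a, b) b).ncard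

/-- `T` realizes the family `D₀` of `k`-weights. -/
def Realizes (T : WTree n) (k : ℕ) (D₀ : Finset (Fin n) → ℝ) : Prop :=
  ∀ I : Finset (Fin n), I.card = k → T.D I = D₀ I

/-- Two leaves are neighbours if the path between them contains exactly one node. -/
def Neighbours (T : WTree n) (i j : Fin n) : Prop :=
  i ≠ j ∧ ∃ p : T.G.Walk (T.leaf i) (T.leaf j), p.IsPath ∧
    ∃! v : T.V, v ∈ p.support ∧ T.IsNode v

/-- The Buneman index `⟨i,j | l,m⟩` holds iff the paths `i–j` and `l–m` are disjoint,
equivalently in `T|_{i,j,l,m}` the leaves `i,j` are neighbours, `l,m` are neighbours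
and `i,l` are not neighbours. -/
def Buneman (T : WTree n) (i j l m : Fin n) : Prop :=
  ∀ (p : T.G.Walk (T.leaf i) (T.leaf j)) (q : T.G.Walk (T.leaf l) (T.leaf m)),
    p.IsPath → q.IsPath → ∀ v : T.V, v ∈ p.support → v ∉ q.support

/-- The minimal subtree spanned by the four leaves `i,j,l,m` is a star (i.e. all
pairwise paths share a common vertex). -/
def StarQuartet (T : WTree n) (i j l m : Fin n) : Prop :=
  ∃ c : T.V, ∀ x ∈ ({i, j, l, m} : Set (Fin n)), ∀ y ∈ ({i, j, l, m} : Set (Fin n)),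
    x ≠ y → ∀ p : T.G.Walk (T.leaf x) (T.leaf y), p.IsPath → c ∈ p.support

/-- A cherry: a set of leaves pairwise neighbours. -/
def IsCherry (T : WTree n) (C : Set (Fin n)) : Prop :=
  ∀ i ∈ C, ∀ j ∈ C, i ≠ j → T.Neighbours i j

/-- A complete cherry: a cherry not strictly contained in another cherry. -/
def IsCompleteCherry (T : WTree n) (C : Set (Fin n)) : Prop :=
  T.IsCherry C ∧ ¬ ∃ C' : Set (Fin n), T.IsCherry C' ∧ C ⊂ C'

/-- A star is a tree with only one node. -/
def IsStar (T : WTree n) : Prop := ∃! v : T.V, T.IsNode v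

/-- `x` is the median of the three leaves `a,b,c`: it lies on all three pairwise paths. -/
def IsMedian (T : WTree n) (a b c : Fin n) (x : T.V) : Prop :=
  (∀ p : T.G.Walk (T.leaf a) (T.leaf b), p.IsPath → x ∈ p.support) ∧
  (∀ p : T.G.Walk (T.leaf a) (T.leaf c), p.IsPath → x ∈ p.support) ∧
  (∀ p : T.G.Walk (T.leaf b) (T.leaf c), p.IsPath → x ∈ p.support)

/-- The weight of the twig associated to the leaf `i` (the path from the leaf to the
nearest node). -/
noncomputable def twigWeight (T : WTree n) (i : Fin n) : ℝ :=
  ∑ᶠ e ∈ {e : Sym2 T.V | ∃ v : T.V, T.IsNode v ∧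
      ∃ p : T.G.Walk (T.leaf i) v, p.IsPath ∧
        (∀ u ∈ p.support, T.IsNode u → u = v) ∧ e ∈ p.edges}, T.w e

/-- Two weighted trees with leaf set `Fin n` are equal (isomorphic respecting the
leaf labels and the weights). -/
def Isom (T T' : WTree n) : Prop :=
  ∃ φ : T.V ≃ T'.V,
    (∀ a b : T.V, T.G.Adj a b ↔ T'.G.Adj (φ a) (φ b)) ∧
    (∀ i : Fin n, φ (T.leaf i) = T'.leaf i) ∧
    (∀ a b : T.V, T.w s(a, b) = T'.w s(φ a, φ b))

/-- `T'` is obtained from `T` by the `k`-IO operation on the edge `{a, b}`: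
the edge divides the leaf set into two parts each of cardinality `< k`; it is
contracted (via the quotient map `φ`) and `w{a,b}/k` is added to the weight of
every twig (i.e. to every pendant edge). -/
def IOStepOn (k : ℕ) (T T' : WTree n) (a b : T.V) : Prop :=
  T.G.Adj a b ∧
  (T.sideLeaves s(a, b) a).ncard < k ∧ (T.sideLeaves s(a, b) b).ncard < k ∧
  ∃ φ : T.V → T'.V,
    Function.Surjective φ ∧ φ a = φ b ∧
    (∀ x y : T.V, φ x = φ y → x = y ∨ s(x, y) = s(a, b)) ∧
    (∀ i : Fin n, φ (T.leaf i) = T'.leaf i) ∧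
    (∀ u v : T'.V, T'.G.Adj u v ↔
      ∃ x y : T.V, φ x = u ∧ φ y = v ∧ T.G.Adj x y ∧ s(x, y) ≠ s(a, b)) ∧
    (∀ x y : T.V, T.G.Adj x y → s(x, y) ≠ s(a, b) →
      ((∃ i : Fin n, T.leaf i = x ∨ T.leaf i = y) →
        T'.w s(φ x, φ y) = T.w s(x, y) + T.w s(a, b) / k) ∧
      (¬ (∃ i : Fin n, T.leaf i = x ∨ T.leaf i = y) →
        T'.w s(φ x, φ y) = T.w s(x, y)))

/-- `T'` is obtained from `T` by a `k`-IO operation. -/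
def IOStep (k : ℕ) (T T' : WTree n) : Prop := ∃ a b : T.V, IOStepOn k T T' a b

/-- `T'` is obtained from `T` by a `k`-OI operation (the inverse of a `k`-IO operation). -/
def OIStep (k : ℕ) (T T' : WTree n) : Prop := IOStep k T' T

/-- `T'` is obtained from `T` by inserting an internal edge of weight `0`
(the inverse of contracting it). -/
def InsertZeroStep (T T' : WTree n) : Prop :=
  ∃ a b : T'.V, T'.G.Adj a b ∧ ¬ T'.IsTwigEdge s(a, b) ∧ T'.w s(a, b) = 0 ∧
    ∃ φ : T'.V → T.V,
      Function.Surjective φ ∧ φ a = φ b ∧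
      (∀ x y : T'.V, φ x = φ y → x = y ∨ s(x, y) = s(a, b)) ∧
      (∀ i : Fin n, φ (T'.leaf i) = T.leaf i) ∧
      (∀ u v : T.V, T.G.Adj u v ↔
        ∃ x y : T'.V, φ x = u ∧ φ y = v ∧ T'.G.Adj x y ∧ s(x, y) ≠ s(a, b)) ∧
      (∀ x y : T'.V, T'.G.Adj x y → s(x, y) ≠ s(a, b) → T.w s(φ x, φ y) = T'.w s(x, y))

/-- Replace the weight function of `T`. -/
def reweight (T : WTree n) (w' : Sym2 T.V → ℝ)
    (h : ∀ e, e ∉ T.G.edgeSet → w' e = 0) : WTree n :=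
  { T with w := w', wSupport := h }

end WTree

namespace WTree

variable {n : ℕ} {T : WTree n} {e f : Sym2 T.V} {u v x y : T.V}

/-- `u` and `v` are joined by a walk avoiding the edge `e`. -/
def Joined (T : WTree n) (e : Sym2 T.V) (u v : T.V) : Prop :=
  (T.G.deleteEdges {e}).Reachable u v


theorem Joined.refl (u : T.V) : T.Joined e u u := SimpleGraph.Reachable.refl u

theorem Joined.symm (h : T.Joined e u v) : T.Joined e v u := SimpleGraph.Reachable.symm h

theorem Joined.trans (h : T.Joined e u v) (h' : T.Joined e v x) : T.Joined e u x :=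
  SimpleGraph.Reachable.trans h h'

theorem joined_of_adj (h : T.G.Adj u v) (he : s(u, v) ≠ e) : T.Joined e u v :=
  SimpleGraph.Adj.reachable (by simpa [SimpleGraph.deleteEdges_adj] using ⟨h, he⟩)

theorem joined_of_notMem_edges (p : T.G.Walk u v) (h : e ∉ p.edges) : T.Joined e u v :=
  ⟨p.toDeleteEdge e h⟩

theorem not_joined_of_mem_edges {p : T.G.Walk u v} (hp : p.IsPath) (h : e ∈ p.edges) :
    ¬ T.Joined e u v := by
  rintro ⟨q⟩
  classical
  have hq : (q.toPath.1.mapLe (T.G.deleteEdges_le {e})).IsPath :=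
    (SimpleGraph.Walk.isPath_mapLe _).2 q.toPath.2
  rw [(T.isTree.existsUnique_path u v).unique hp hq, SimpleGraph.Walk.edges_mapLe_eq_edges] at h
  have := SimpleGraph.Walk.edges_subset_edgeSet _ h
  simp [SimpleGraph.edgeSet_deleteEdges] at this

theorem mem_pathEdges_iff : e ∈ T.pathEdges u v ↔ ¬ T.Joined e u v := by
  constructor
  · rintro ⟨p, hp, he⟩
    exact not_joined_of_mem_edges hp he
  · intro h
    obtain ⟨p, hp, -⟩ := T.isTree.existsUnique_path u v
    exact ⟨p, hp, by_contra fun he => h (joined_of_notMem_edges p he)⟩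

theorem mem_edges_iff {p : T.G.Walk u v} (hp : p.IsPath) : e ∈ p.edges ↔ ¬ T.Joined e u v :=
  ⟨not_joined_of_mem_edges hp, fun h => by_contra fun he => h (joined_of_notMem_edges p he)⟩

theorem mem_edgeSet_of_not_joined (h : ¬ T.Joined e u v) : e ∈ T.G.edgeSet := by
  obtain ⟨p, -, he⟩ := mem_pathEdges_iff.2 h
  exact p.edges_subset_edgeSet he

theorem joined_or_joined (a b x : T.V) : T.Joined s(a, b) x a ∨ T.Joined s(a, b) x b := by
  obtain ⟨p, -, -⟩ := T.isTree.existsUnique_path x a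
  induction p with
  | nil => exact Or.inl (.refl _)
  | @cons x y a h p ih =>
    by_cases hxy : s(x, y) = s(a, b)
    · rcases Sym2.eq_iff.1 hxy with ⟨rfl, -⟩ | ⟨rfl, -⟩
      · exact Or.inl (.refl _)
      · exact Or.inr (.refl _)
    · exact ih.imp (joined_of_adj h hxy).trans (joined_of_adj h hxy).trans

/-- Deleting an edge leaves at most two components. -/
theorem joined_of_not_joined (huv : ¬ T.Joined e u v) (hvx : ¬ T.Joined e v x) :
    T.Joined e u x := by
  induction e with | h a b =>
  rcases joined_or_joined a b u with hu | hu <;> rcases joined_or_joined a b v with hv | hv <;>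
    rcases joined_or_joined a b x with hx | hx
  all_goals first
    | exact hu.trans hx.symm
    | exact absurd (hu.trans hv.symm) huv
    | exact absurd (hv.trans hx.symm) hvx

/-- The component of `x` in the complement of `e` is not cut by an edge with an endpoint in the
other component. -/
theorem joined_of_not_joined_endpoint {c : T.V} (hc : c ∈ f) (hx : ¬ T.Joined e c x)
    (h : T.Joined e x y) : T.Joined f x y := by
  obtain ⟨p⟩ := h
  induction p with
  | nil => exact .refl _
  | @cons x z y hxz p ih =>
    have hz : T.Joined e x z := SimpleGraph.Adj.reachable hxz
    refine (joined_of_adj (T.G.deleteEdges_le _ hxz) ?_).trans (ih fun h => hx (h.trans hz.symm))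
    rintro rfl
    rcases Sym2.mem_iff.1 hc with rfl | rfl
    · exact hx (.refl _)
    · exact hx hz.symm

theorem not_joined_self (h : T.G.Adj u v) : ¬ T.Joined s(u, v) u v :=
  not_joined_of_mem_edges (SimpleGraph.Walk.IsPath.of_adj h) (by simp)

theorem finite_set (s : Set T.V) : s.Finite :=
  haveI := T.fintypeV
  s.toFinite

theorem deg_pos (h : T.G.Adj u v) : 0 < T.deg u :=
  (Set.ncard_pos (finite_set _)).2 ⟨v, h⟩

/-- Every branch of the tree contains a leaf. -/
theorem exists_leaf_not_joined (h : T.G.Adj u v) :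
    ∃ i, ¬ T.Joined s(u, v) u (T.leaf i) := by
  induction hk : {x | ¬ T.Joined s(u, v) u x}.ncard using Nat.strong_induction_on
    generalizing u v with
  | _ k ih =>
  by_cases hv : T.deg v = 1
  · obtain ⟨i, rfl⟩ := (T.leafSpec v).1 hv
    exact ⟨i, not_joined_self h⟩
  · obtain ⟨z, hz, hzu⟩ : ∃ z ∈ T.G.neighborSet v, z ≠ u :=
      Set.exists_ne_of_one_lt_ncard (by have := deg_pos h.symm; unfold deg at *; omega) u
    have hne : s(v, u) ≠ s(v, z) := by
      rw [Ne, Sym2.congr_right]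
      exact hzu.symm
    have key : ∀ x, ¬ T.Joined s(v, z) v x → ¬ T.Joined s(u, v) u x := fun x hx hux =>
      hx ((joined_of_adj h.symm hne).trans
        (joined_of_not_joined_endpoint (Sym2.mem_mk_left v z)
          (fun h' => not_joined_self h h'.symm) hux))
    have hlt : {x | ¬ T.Joined s(v, z) v x}.ncard < k := by
      rw [← hk]
      refine Set.ncard_lt_ncard ⟨key, fun hsub => ?_⟩ (finite_set _)
      exact hsub (not_joined_self h) (.refl v)
    obtain ⟨i, hi⟩ := ih _ hlt hz rfl
    exact ⟨i, key _ hi⟩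

theorem ncard_neighborSet_toSubgraph {p : T.G.Walk u v} (hp : p.IsPath) {b : T.V}
    (hb : b ∈ p.support) (hu : b ≠ u) (hv : b ≠ v) :
    (p.toSubgraph.neighborSet b).ncard = 2 := by
  obtain ⟨k, rfl, hk⟩ := SimpleGraph.Walk.mem_support_iff_exists_getVert.1 hb
  refine hp.ncard_neighborSet_toSubgraph_internal_eq_two ?_ (lt_of_le_of_ne hk ?_)
  · rintro rfl
    simp at hu
  · rintro rfl
    simp at hv

theorem isNode_of_mem_support (hess : T.Essential) {p : T.G.Walk u v} (hp : p.IsPath) {b : T.V}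
    (hb : b ∈ p.support) (hu : b ≠ u) (hv : b ≠ v) : T.IsNode b := by
  have h2 := ncard_neighborSet_toSubgraph hp hb hu hv
  have hle : _ ≤ T.deg b :=
    Set.ncard_le_ncard (p.toSubgraph.neighborSet_subset b) (finite_set _)
  exact lt_of_le_of_ne (h2 ▸ hle) (hess b).symm

/-- From every interior vertex of a path in an essential tree, some leaf can be reached along a
branch avoiding the path. -/
theorem exists_leaf_joined (hess : T.Essential) {p : T.G.Walk u v} (hp : p.IsPath) {b : T.V}
    (hb : b ∈ p.support) (hu : b ≠ u) (hv : b ≠ v) :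
    ∃ i, ∀ e ∈ p.edges, T.Joined e b (T.leaf i) := by
  have hlt : (p.toSubgraph.neighborSet b).ncard < (T.G.neighborSet b).ncard := by
    rw [ncard_neighborSet_toSubgraph hp hb hu hv]
    exact isNode_of_mem_support hess hp hb hu hv
  obtain ⟨y, hy, hyp⟩ := Set.exists_mem_notMem_of_ncard_lt_ncard hlt (finite_set _)
  have hg : s(b, y) ∉ p.edges := fun h => hyp (p.adj_toSubgraph_iff_mem_edges.2 h)
  have hsupp : ∀ c ∈ p.support, T.Joined s(b, y) c u := by
    classical
    intro c hc
    exact (joined_of_notMem_edges (p.takeUntil c hc)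
      fun h => hg (p.edges_takeUntil_subset_edges hc h)).symm
  obtain ⟨i, hi⟩ := exists_leaf_not_joined hy
  refine ⟨i, fun e he => ?_⟩
  have hne : s(b, y) ≠ e := fun h => hg (h ▸ he)
  refine (joined_of_adj hy hne).trans ?_
  induction e with | h c d =>
  have hc : T.Joined s(b, y) c b :=
    (hsupp c (p.fst_mem_support_of_mem_edges he)).trans (hsupp b hb).symm
  exact joined_of_not_joined_endpoint (Sym2.mem_mk_left c d)
    (fun h => not_joined_self hy (hc.symm.trans h))
    (joined_of_not_joined (fun h => not_joined_self hy h.symm) hi)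

theorem exists_not_joined (h : u ≠ v) : ∃ e, ¬ T.Joined e u v := by
  obtain ⟨p, hp, -⟩ := T.isTree.existsUnique_path u v
  cases p with
  | nil => exact absurd rfl h
  | cons h q =>
    exact ⟨_, not_joined_of_mem_edges hp (by rw [SimpleGraph.Walk.edges_cons]; exact .head _)⟩

theorem exists_mem_edges_not_joined (p : T.G.Walk u v) (hx : x ∈ p.support) (hy : y ∈ p.support)
    (h : x ≠ y) : ∃ e ∈ p.edges, ¬ T.Joined e x y := by
  classical
  obtain ⟨e, he⟩ := exists_not_joined h
  refine ⟨e, by_contra fun hep => he ?_, he⟩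
  have hsupp : ∀ c ∈ p.support, T.Joined e u c := fun c hc =>
    joined_of_notMem_edges (p.takeUntil c hc)
      fun h => hep (p.edges_takeUntil_subset_edges hc h)
  exact (hsupp x hx).symm.trans (hsupp y hy)

variable {i j l m : Fin n}

theorem deg_leaf (T : WTree n) (i : Fin n) : T.deg (T.leaf i) = 1 :=
  (T.leafSpec _).2 ⟨i, rfl⟩

theorem not_isNode_leaf (T : WTree n) (i : Fin n) : ¬ T.IsNode (T.leaf i) := by
  simp [IsNode, deg_leaf]

theorem leaf_adj_unique (hx : T.G.Adj (T.leaf i) x) (hy : T.G.Adj (T.leaf i) y) : x = y := by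
  obtain ⟨b, hb⟩ := Set.ncard_eq_one.1 (T.deg_leaf i)
  have hx' : x ∈ T.G.neighborSet (T.leaf i) := hx
  have hy' : y ∈ T.G.neighborSet (T.leaf i) := hy
  rw [hb] at hx' hy'
  exact hx'.trans hy'.symm

/-- The edge at a leaf isolates that leaf. -/
theorem leaf_eq_of_joined (h : T.G.Adj (T.leaf i) x) (hj : T.Joined s(T.leaf i, x) (T.leaf i) y) :
    T.leaf i = y := by
  obtain ⟨p⟩ := hj
  cases p with
  | nil => rfl
  | cons h' q =>
    rw [SimpleGraph.deleteEdges_adj] at h'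
    exact absurd (by rw [leaf_adj_unique h h'.1]; rfl) h'.2

theorem neighbours_iff (hess : T.Essential) :
    T.Neighbours i j ↔ i ≠ j ∧ ∃ b, T.G.Adj (T.leaf i) b ∧ T.G.Adj (T.leaf j) b := by
  refine and_congr_right fun hij => ⟨?_, ?_⟩
  · rintro ⟨p, hp, b, ⟨hb, hbn⟩, huniq⟩
    have hint : ∀ c ∈ p.support, c ≠ T.leaf i → c ≠ T.leaf j → c = b := fun c hc h h' =>
      huniq c ⟨hc, isNode_of_mem_support hess hp hc h h'⟩
    have hbi : b ≠ T.leaf i := by rintro rfl; exact T.not_isNode_leaf i hbn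
    have hbj : b ≠ T.leaf j := by rintro rfl; exact T.not_isNode_leaf j hbn
    generalize T.leaf i = u at *
    generalize T.leaf j = v at *
    match p with
    | .nil => simp_all
    | .cons h .nil => simp_all
    | .cons h (.cons h' .nil) =>
      exact ⟨_, h, h'.symm⟩
    | .cons (v := c) h (.cons (v := d) h' (.cons h'' q)) =>
      simp only [SimpleGraph.Walk.cons_isPath_iff, SimpleGraph.Walk.support_cons,
        List.mem_cons, not_or] at hp hint
      have hv := q.end_mem_support
      have hc := hint c (by simp) (by tauto) (by rintro rfl; tauto)
      have hd := hint d (by simp) (by tauto) (by rintro rfl; tauto)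
      exact absurd (hc.trans hd.symm) (by tauto)
  · rintro ⟨b, hi, hj⟩
    have hne : T.leaf i ≠ T.leaf j := fun h => hij (T.leafInj h)
    have hp : (SimpleGraph.Walk.cons hi (.cons hj.symm .nil)).IsPath := by
      simp [SimpleGraph.Walk.cons_isPath_iff, hi.ne, hj.ne', hne]
    refine ⟨_, hp, b, ⟨by simp, isNode_of_mem_support hess hp (by simp) hi.ne' hj.ne'⟩, ?_⟩
    rintro c ⟨hc, hcn⟩
    simp only [SimpleGraph.Walk.support_cons, SimpleGraph.Walk.support_nil, List.mem_cons,
      List.not_mem_nil, or_false] at hc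
    rcases hc with rfl | rfl | rfl
    · exact absurd hcn (T.not_isNode_leaf i)
    · rfl
    · exact absurd hcn (T.not_isNode_leaf j)

theorem Neighbours.symm (hess : T.Essential) (h : T.Neighbours i j) : T.Neighbours j i := by
  rw [neighbours_iff hess] at h ⊢
  obtain ⟨hij, b, hi, hj⟩ := h
  exact ⟨hij.symm, b, hj, hi⟩

/-- The edge `e` separates the leaves `i, j` from the leaves `l, m`. -/
def Split (T : WTree n) (e : Sym2 T.V) (i j l m : Fin n) : Prop :=
  T.Joined e (T.leaf i) (T.leaf j) ∧ T.Joined e (T.leaf l) (T.leaf m) ∧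
    ¬ T.Joined e (T.leaf i) (T.leaf l)

theorem Split.symm (h : T.Split e i j l m) : T.Split e l m i j :=
  ⟨h.2.1, h.1, fun h' => h.2.2 h'.symm⟩

theorem Split.swap_right (h : T.Split e i j l m) : T.Split e i j m l :=
  ⟨h.1, h.2.1.symm, fun h' => h.2.2 (h'.trans h.2.1.symm)⟩

theorem Split.swap_left (h : T.Split e i j l m) : T.Split e j i l m :=
  h.symm.swap_right.symm

theorem Split.buneman (h : T.Split e i j l m) : T.Buneman i j l m := by
  classical
  intro p q hp hq v hvp hvq
  have h1 : T.Joined e (T.leaf i) v := joined_of_notMem_edges (p.takeUntil v hvp)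
    fun h' => (mem_edges_iff hp).1 (p.edges_takeUntil_subset_edges hvp h') h.1
  have h2 : T.Joined e (T.leaf l) v := joined_of_notMem_edges (q.takeUntil v hvq)
    fun h' => (mem_edges_iff hq).1 (q.edges_takeUntil_subset_edges hvq h') h.2.1
  exact h.2.2 (h1.trans h2.symm)

theorem Buneman.exists_split (h : T.Buneman i j l m) : ∃ e, T.Split e i j l m := by
  obtain ⟨p, hp, -⟩ := T.isTree.existsUnique_path (T.leaf i) (T.leaf j)
  obtain ⟨q, hq, -⟩ := T.isTree.existsUnique_path (T.leaf l) (T.leaf m)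
  obtain ⟨r, hr, -⟩ := T.isTree.existsUnique_path (T.leaf i) (T.leaf l)
  have hdisj := h p q hp hq
  obtain ⟨d, hd, hd1, hd2⟩ := r.exists_boundary_dart {v | v ∈ p.support} p.start_mem_support
    (fun h' => hdisj _ h' q.start_mem_support)
  refine ⟨d.edge, joined_of_notMem_edges p fun h' => hd2 ?_,
    joined_of_notMem_edges q fun h' => hdisj _ hd1 ?_,
    not_joined_of_mem_edges hr (List.mem_map_of_mem hd)⟩
  · exact p.snd_mem_support_of_mem_edges h'
  · exact q.fst_mem_support_of_mem_edges h'

theorem Split.not_split (h : T.Split e i j l m) : ¬ T.Split f i l j m := by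
  intro hf
  induction f with | h c d =>
  by_cases hc : T.Joined e c (T.leaf i)
  · have hl : ¬ T.Joined e c (T.leaf l) := fun h' => h.2.2 (hc.symm.trans h')
    have := joined_of_not_joined_endpoint (Sym2.mem_mk_left c d) hl h.2.1
    exact hf.2.2 (hf.1.trans (this.trans hf.2.1.symm))
  · exact hf.2.2 (joined_of_not_joined_endpoint (Sym2.mem_mk_left c d) hc h.1)

theorem Split.ne_zero (hinz : T.InternalNonzero) (hess : T.Essential) (hij : i ≠ j) (hlm : l ≠ m)
    (h : T.Split e i j l m) : T.w e ≠ 0 := by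
  refine hinz e (mem_edgeSet_of_not_joined h.2.2) ?_
  rintro ⟨x, v, hv, p, hp, hpn, he⟩
  have hxv : T.leaf x ≠ v := by rintro rfl; exact T.not_isNode_leaf x hv
  obtain ⟨b, hb, rfl⟩ : ∃ b, T.G.Adj (T.leaf x) b ∧ e = s(T.leaf x, b) := by
    have hint : ∀ c ∈ p.support, c ≠ T.leaf x → c = v := fun c hc h =>
      by_contra fun h' => h' (hpn c hc (isNode_of_mem_support hess hp hc h h'))
    clear hpn
    generalize T.leaf x = u at *
    match p with
    | .nil => simp at he
    | .cons h .nil => exact ⟨_, h, by simpa using he⟩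
    | .cons (v := c) h (.cons h' q) =>
      have hc := hint c (by simp) h.ne'
      subst hc
      simp [SimpleGraph.Walk.cons_isPath_iff] at hp
  have iso : ∀ y, T.Joined s(T.leaf x, b) (T.leaf x) (T.leaf y) → x = y := fun y hy =>
    T.leafInj (leaf_eq_of_joined hb hy)
  by_cases hx : T.Joined s(T.leaf x, b) (T.leaf x) (T.leaf i)
  · exact hij ((iso i hx).symm.trans (iso j (hx.trans h.1)))
  · have hx := joined_of_not_joined hx h.2.2
    exact hlm ((iso l hx).symm.trans (iso m (hx.trans h.2.1)))

theorem Split.neighbours (hess : T.Essential) (hij : i ≠ j) (h : T.Split e i j l m)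
    (hA : ∀ x, T.Joined e (T.leaf i) (T.leaf x) → x = i ∨ x = j) : T.Neighbours i j := by
  obtain ⟨p, hp, -⟩ := T.isTree.existsUnique_path (T.leaf i) (T.leaf j)
  have hep : e ∉ p.edges := fun h' => not_joined_of_mem_edges hp h' h.1
  have attach : ∀ b ∈ p.support, b ≠ T.leaf i → b ≠ T.leaf j →
      ∃ x, (∀ f ∈ p.edges, T.Joined f b (T.leaf x)) ∧ ¬ T.Joined e (T.leaf i) (T.leaf x) := by
    intro b hb hbi hbj
    obtain ⟨x, hx⟩ := exists_leaf_joined hess hp hb hbi hbj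
    refine ⟨x, hx, fun hex => ?_⟩
    rcases hA x hex with rfl | rfl
    · obtain ⟨f, hf, hf'⟩ := exists_mem_edges_not_joined p hb p.start_mem_support hbi
      exact hf' (hx f hf)
    · obtain ⟨f, hf, hf'⟩ := exists_mem_edges_not_joined p hb p.end_mem_support hbj
      exact hf' (hx f hf)
  have huniq : ∀ b ∈ p.support, b ≠ T.leaf i → b ≠ T.leaf j →
      ∀ c ∈ p.support, c ≠ T.leaf i → c ≠ T.leaf j → b = c := by
    classical
    intro b hb hbi hbj c hc hci hcj
    by_contra hbc
    obtain ⟨x, hx, hex⟩ := attach b hb hbi hbj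
    obtain ⟨y, hy, hey⟩ := attach c hc hci hcj
    obtain ⟨f, hf, hf'⟩ := exists_mem_edges_not_joined p hb hc hbc
    refine hf' ((hx f hf).trans (.trans ?_ (hy f hf).symm))
    induction f with | h s t =>
    have hs : T.Joined e (T.leaf i) s := by
      have hs := p.fst_mem_support_of_mem_edges hf
      exact joined_of_notMem_edges (p.takeUntil s hs)
        fun h' => hep (p.edges_takeUntil_subset_edges hs h')
    exact joined_of_not_joined_endpoint (Sym2.mem_mk_left s t) (fun h' => hex (hs.trans h'))
      (joined_of_not_joined (fun h' => hex h'.symm) hey)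
  have hnadj : ¬ T.G.Adj (T.leaf i) (T.leaf j) := by
    intro hadj
    have hil : ¬ T.Joined s(T.leaf i, T.leaf j) (T.leaf i) (T.leaf l) := by
      intro h'
      exact h.2.2 (leaf_eq_of_joined hadj h' ▸ .refl _)
    have hjl : ¬ T.Joined s(T.leaf i, T.leaf j) (T.leaf j) (T.leaf l) := by
      intro h'
      rw [Sym2.eq_swap] at h'
      have := leaf_eq_of_joined hadj.symm h'
      exact h.2.2 (this ▸ h.1)
    exact not_joined_self hadj (joined_of_not_joined hil fun h' => hjl h'.symm)
  rw [neighbours_iff hess]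
  refine ⟨hij, ?_⟩
  have hne : T.leaf i ≠ T.leaf j := fun h => hij (T.leafInj h)
  clear attach hep h hA
  generalize T.leaf i = u at *
  generalize T.leaf j = v at *
  match p with
  | .nil => simp_all
  | .cons h .nil => simp_all
  | .cons h (.cons h' .nil) => exact ⟨_, h, h'.symm⟩
  | .cons (v := c) h (.cons (v := d) h' (.cons h'' q)) =>
    simp only [SimpleGraph.Walk.cons_isPath_iff, SimpleGraph.Walk.support_cons,
      List.mem_cons, not_or] at hp huniq
    have hv := q.end_mem_support
    have := huniq c (by simp) (by tauto) (by rintro rfl; tauto)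
      d (by simp) (by tauto) (by rintro rfl; tauto)
    exact absurd this (by tauto)

theorem Split.isCompleteCherry (hess : T.Essential) (hij : i ≠ j) (hlm : l ≠ m)
    (h : T.Split e i j l m) (hA : ∀ x, T.Joined e (T.leaf i) (T.leaf x) → x = i ∨ x = j) :
    T.IsCompleteCherry {i, j} := by
  have hN := h.neighbours hess hij hA
  constructor
  · rintro x (rfl | rfl) y (rfl | rfl) hxy
    · exact absurd rfl hxy
    · exact hN
    · exact hN.symm hess
    · exact absurd rfl hxy
  · rintro ⟨C, hC, hsub⟩
    obtain ⟨x, hxC, hx⟩ := Set.exists_of_ssubset hsub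
    have hxi : x ≠ i := fun h => hx (by simp [h])
    have hxj : x ≠ j := fun h => hx (by simp [h])
    obtain ⟨-, b, hib, hjb⟩ := (neighbours_iff hess).1 hN
    obtain ⟨-, c, hic, hxc⟩ := (neighbours_iff hess).1 (hC i (hsub.1 (by simp)) x hxC hxi.symm)
    obtain rfl := leaf_adj_unique hib hic
    have hex : ¬ T.Joined e (T.leaf x) (T.leaf i) := fun h' => (hA x h'.symm).elim hxi hxj
    have hei : T.Joined e (T.leaf i) b := by
      refine joined_of_adj hib ?_
      rintro rfl
      exact hij (T.leafInj (leaf_eq_of_joined hib h.1))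
    have he : s(T.leaf x, b) = e := by_contra fun h' =>
      hex ((joined_of_adj hxc h').trans hei.symm)
    subst he
    have hxl := joined_of_not_joined hex h.2.2
    exact hlm (T.leafInj ((leaf_eq_of_joined hxc hxl).symm.trans
      (leaf_eq_of_joined hxc (hxl.trans h.2.1))))

theorem IsCompleteCherry.buneman (hess : T.Essential) (hij : i ≠ j) (hil : i ≠ l) (him : i ≠ m)
    (hjl : j ≠ l) (hjm : j ≠ m) (hlm : l ≠ m) (h : T.IsCompleteCherry {i, j})
    (h' : T.IsCompleteCherry {l, m}) : T.Buneman i j l m := by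
  have hN := h.1 i (by simp) j (by simp) hij
  have hN' := h'.1 l (by simp) m (by simp) hlm
  obtain ⟨-, b, hib, hjb⟩ := (neighbours_iff hess).1 hN
  obtain ⟨-, c, hlc, hmc⟩ := (neighbours_iff hess).1 hN'
  have hbc : b ≠ c := by
    rintro rfl
    have hall : ∀ x ∈ ({i, j, l} : Set (Fin n)), T.G.Adj (T.leaf x) b := by
      rintro x (rfl | rfl | rfl) <;> assumption
    refine h.2 ⟨{i, j, l}, fun x hx y hy hxy =>
      (neighbours_iff hess).2 ⟨hxy, b, hall x hx, hall y hy⟩, ?_, ?_⟩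
    · rintro x (rfl | rfl) <;> simp
    · intro hsub
      rcases hsub (show l ∈ ({i, j, l} : Set (Fin n)) by simp) with rfl | h
      · exact hil rfl
      · exact hjl h.symm
  have path : ∀ {x y : Fin n} {d}, x ≠ y → T.G.Adj (T.leaf x) d → T.G.Adj (T.leaf y) d →
      ∀ p : T.G.Walk (T.leaf x) (T.leaf y), p.IsPath →
        p.support = [T.leaf x, d, T.leaf y] := by
    intro x y d hxy hx hy p hp
    have hne : T.leaf x ≠ T.leaf y := fun h => hxy (T.leafInj h)
    have hq : (SimpleGraph.Walk.cons hx (.cons hy.symm .nil)).IsPath := by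
      simp [SimpleGraph.Walk.cons_isPath_iff, hx.ne, hy.ne', hne]
    rw [(T.isTree.existsUnique_path _ _).unique hp hq]
    rfl
  have hnode : ∀ {x y : Fin n} {d}, x ≠ y → T.G.Adj (T.leaf x) d → T.G.Adj (T.leaf y) d →
      ∀ z, d ≠ T.leaf z := by
    rintro x y d hxy hx hy z rfl
    exact hxy (T.leafInj (leaf_adj_unique hx.symm hy.symm))
  intro p q hp hq v hvp hvq
  rw [path hij hib hjb p hp] at hvp
  rw [path hlm hlc hmc q hq] at hvq
  have h1 := hnode hij hib hjb
  have h2 := hnode hlm hlc hmc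
  have inj := fun x y => (T.leafInj.ne_iff (x := x) (y := y)).2
  simp only [List.mem_cons, List.not_mem_nil, or_false] at hvp hvq
  rcases hvp with rfl | rfl | rfl
  · rcases hvq with h | h | h
    · exact inj _ _ hil h
    · exact h2 _ h.symm
    · exact inj _ _ him h
  · rcases hvq with h | h | h
    · exact h1 _ h
    · exact hbc h
    · exact h1 _ h
  · rcases hvq with h | h | h
    · exact inj _ _ hjl h
    · exact h2 _ h.symm
    · exact inj _ _ hjm h

theorem Split.mem_edges {p : T.G.Walk (T.leaf i) (T.leaf l)} (hp : p.IsPath)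
    (h : T.Split e i j l m) : e ∈ p.edges :=
  (mem_edges_iff hp).2 h.2.2

theorem Split.joined_right (h : T.Split e i j l m) (hv : ¬ T.Joined e v (T.leaf i)) :
    T.Joined e v (T.leaf l) :=
  joined_of_not_joined hv h.2.2

/-- Edges inducing the same split of four leaves are linearly ordered along the path. -/
theorem Split.total (he : T.Split e i j l m) (hf : T.Split f i j l m) :
    (∀ v, T.Joined e v (T.leaf i) → T.Joined f v (T.leaf i)) ∨
      (∀ v, T.Joined f v (T.leaf i) → T.Joined e v (T.leaf i)) := by
  induction f with | h c d =>
  by_cases hc : T.Joined e c (T.leaf i)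
  · refine Or.inr fun v hv => by_contra fun hv' => hf.2.2 ?_
    have hvl := he.joined_right hv'
    exact hv.symm.trans (joined_of_not_joined_endpoint (Sym2.mem_mk_left c d)
      (fun h => hv' (h.symm.trans hc)) hvl)
  · exact Or.inl fun v hv => joined_of_not_joined_endpoint (Sym2.mem_mk_left c d)
      (fun h => hc (h.trans hv)) hv

theorem exists_min_split {s : Set (Sym2 T.V)} (hs : ∀ e ∈ s, T.Split e i j l m)
    (hne : s.Nonempty) :
    ∃ e ∈ s, ∀ f ∈ s, ∀ v, T.Joined e v (T.leaf i) → T.Joined f v (T.leaf i) := by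
  have : Finite T.V := @Finite.of_fintype _ T.fintypeV
  obtain ⟨e, he, hmin⟩ := Set.exists_min_image s
    (fun e => {v | T.Joined e v (T.leaf i)}.ncard) s.toFinite hne
  refine ⟨e, he, fun f hf => ?_⟩
  rcases (hs e he).total (hs f hf) with h | h
  · exact h
  · have heq := Set.eq_of_subset_of_ncard_le (s := {v | T.Joined f v (T.leaf i)})
      (t := {v | T.Joined e v (T.leaf i)}) h (hmin f hf)
    exact fun v hv => (Set.ext_iff.1 heq v).2 hv

/-- Between two edges inducing the same split of four leaves there is a further leaf. -/
theorem Split.exists_leaf_between (hess : T.Essential) (he : T.Split e i j l m)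
    (hf : T.Split f i j l m) (hef : e ≠ f)
    (hle : ∀ v, T.Joined e v (T.leaf i) → T.Joined f v (T.leaf i)) :
    ∃ x, ¬ T.Joined e (T.leaf x) (T.leaf i) ∧ T.Joined f (T.leaf x) (T.leaf i) := by
  obtain ⟨p, hp, -⟩ := T.isTree.existsUnique_path (T.leaf i) (T.leaf l)
  have hep := he.mem_edges hp
  have hfp := hf.mem_edges hp
  obtain ⟨b, hb, hbe, hbf⟩ : ∃ b ∈ p.support, ¬ T.Joined e b (T.leaf i) ∧
      T.Joined f b (T.leaf i) := by
    induction e with | h a b =>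
    have hab := p.adj_of_mem_edges hep
    have hf' := joined_of_adj hab hef
    by_cases ha : T.Joined s(a, b) a (T.leaf i)
    · exact ⟨b, p.snd_mem_support_of_mem_edges hep,
        fun h => not_joined_self hab (ha.trans h.symm), hf'.symm.trans (hle a ha)⟩
    · have hb : T.Joined s(a, b) b (T.leaf i) :=
        joined_of_not_joined (fun h => not_joined_self hab h.symm) ha
      exact ⟨a, p.fst_mem_support_of_mem_edges hep, ha, hf'.trans (hle b hb)⟩
  obtain ⟨x, hx⟩ := exists_leaf_joined hess hp hb (by rintro rfl; exact hbe (.refl _))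
    (by rintro rfl; exact hf.2.2 hbf.symm)
  exact ⟨x, fun h => hbe ((hx e hep).trans h), (hx f hfp).symm.trans hbf⟩

/-- No two leaves of `S` are separated by `e`. -/
def Uncut (T : WTree n) (e : Sym2 T.V) (S : Finset (Fin n)) : Prop :=
  ∀ x ∈ S, ∀ y ∈ S, T.Joined e (T.leaf x) (T.leaf y)

/-- If the edges splitting `i, j` from `l, m` leave enough room on the side of `l, m`, some set of
leaves is cut by all of them but one. -/
theorem exists_isolating_set_of_le {k : ℕ} (h4 : 4 ≤ k) (hess : T.Essential) (hlm : l ≠ m)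
    (hβ : ∀ e, T.Split e i j l m → ∃ x, T.Joined e (T.leaf x) (T.leaf l) ∧ x ≠ l ∧ x ≠ m)
    (hk : ∃ e, T.Split e i j l m ∧ k ≤ {x | T.Joined e (T.leaf x) (T.leaf l)}.ncard) :
    ∃ S : Finset (Fin n), S.card = k - 2 ∧ Disjoint S {i, j, l, m} ∧
      ∃ e, T.Split e i j l m ∧ T.Uncut e S ∧
        ∀ f, T.Split f i j l m → T.Uncut f S → f = e := by
  classical
  obtain ⟨e₀, he₀, hk₀⟩ := hk
  obtain ⟨e, he, hmin⟩ := exists_min_split (s := {e | T.Split e i j l m}) (fun _ h => h)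
    ⟨e₀, he₀⟩
  obtain ⟨g, hg, hmax⟩ := exists_min_split (s := {e | T.Split e i j l m})
    (fun _ h => Split.symm h) ⟨e₀, he₀⟩
  obtain ⟨y, hy, hyl, hym⟩ := hβ g hg
  obtain ⟨z, hzl, hzm, hze, hz⟩ : ∃ z, z ≠ l ∧ z ≠ m ∧ T.Joined e (T.leaf z) (T.leaf l) ∧
      ∀ f, T.Split f i j l m → f ≠ e → T.Joined f (T.leaf z) (T.leaf i) := by
    by_cases h : ∃ f, T.Split f i j l m ∧ f ≠ e
    · obtain ⟨f, ⟨hf, hfe⟩, hmin'⟩ := exists_min_split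
        (s := {f | T.Split f i j l m ∧ f ≠ e}) (fun _ h => h.1) h
      obtain ⟨z, hz, hzf⟩ := he.exists_leaf_between hess hf hfe.symm (hmin f hf)
      refine ⟨z, ?_, ?_, he.joined_right hz, fun f' hf' hne => hmin' f' ⟨hf', hne⟩ _ hzf⟩
      · rintro rfl
        exact hf.2.2 hzf.symm
      · rintro rfl
        exact hf.swap_right.2.2 hzf.symm
    · exact ⟨y, hyl, hym, hmax e he _ hy, fun f hf hne => absurd ⟨f, hf, hne⟩ h⟩
  let B : Finset (Fin n) := {x | T.Joined e (T.leaf x) (T.leaf l)}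
  have hB : k ≤ B.card := by
    refine hk₀.trans ?_
    rw [← Set.ncard_coe_finset]
    refine Set.ncard_le_ncard (fun x hx => ?_) (Finset.finite_toSet _)
    by_contra hx'
    have hx' : ¬ T.Joined e (T.leaf x) (T.leaf l) := by simpa [B] using hx'
    have := hmin e₀ he₀ _ (he.symm.joined_right hx')
    exact he₀.2.2 (this.symm.trans hx)
  have hcard : k - 2 ≤ (B \ {l, m}).card := by
    have := Finset.le_card_sdiff {l, m} B
    have := Finset.card_pair hlm
    omega
  have hsub : ({y, z} : Finset (Fin n)) ⊆ B \ {l, m} := by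
    intro x hx
    rcases Finset.mem_insert.1 hx with rfl | hx
    · simp [B, hmax e he _ hy, hyl, hym]
    · obtain rfl := Finset.mem_singleton.1 hx
      simp [B, hze, hzl, hzm]
  have hyz : ({y, z} : Finset (Fin n)).card ≤ k - 2 := Finset.card_le_two.trans (by omega)
  obtain ⟨S, hS, hSB, hSk⟩ := Finset.exists_subsuperset_card_eq hsub hyz hcard
  have hSl : ∀ x ∈ S, T.Joined e (T.leaf x) (T.leaf l) := fun x hx => by
    have := hSB hx
    simp only [B, Finset.mem_sdiff, Finset.mem_filter] at this
    exact this.1.2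
  refine ⟨S, hSk, ?_, e, he, fun x hx x' hx' => (hSl x hx).trans (hSl x' hx').symm,
    fun f hf hfS => ?_⟩
  · rw [Finset.disjoint_right]
    intro x hx hxS
    have hxB := hSB hxS
    simp only [Finset.mem_insert, Finset.mem_singleton] at hx
    rcases hx with rfl | rfl | hx
    · exact he.2.2 (hSl _ hxS)
    · exact he.swap_left.2.2 (hSl _ hxS)
    · simp only [Finset.mem_sdiff, Finset.mem_insert, Finset.mem_singleton] at hxB
      exact hxB.2 hx
  · by_contra hfe
    have := hfS y (hS (by simp)) z (hS (by simp))
    exact hf.2.2 ((hz f hf hfe).symm.trans (this.symm.trans (hmax f hf _ hy)))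

theorem exists_isolating_set {k : ℕ} (h4 : 4 ≤ k) (hk : k ≤ n - 2) (hess : T.Essential)
    (hps : T.IsPseudostar k) (hij : i ≠ j) (hlm : l ≠ m) (he : T.Split e i j l m)
    (hc : ¬ (T.IsCompleteCherry {i, j} ∧ T.IsCompleteCherry {l, m})) :
    ∃ S : Finset (Fin n), S.card = k - 2 ∧ Disjoint S {i, j, l, m} ∧
      ∃ e, T.Split e i j l m ∧ T.Uncut e S ∧
        ∀ f, T.Split f i j l m → T.Uncut f S → f = e := by
  have large : ∀ {e} {i j l m : Fin n}, T.Split e i j l m →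
      (∀ x, T.Joined e (T.leaf x) (T.leaf i) → x = i ∨ x = j) →
      k ≤ {x | T.Joined e (T.leaf x) (T.leaf l)}.ncard := by
    intro e i j l m he hA
    have hsub : ({i, j} : Set (Fin n))ᶜ ⊆ {x | T.Joined e (T.leaf x) (T.leaf l)} :=
      fun x hx => he.joined_right fun h => hx (hA x h)
    have h1 := Set.ncard_le_ncard hsub (Set.toFinite _)
    have h2 := Set.ncard_add_ncard_compl ({i, j} : Set (Fin n))
    have h3 := Set.ncard_insert_le i ({j} : Set (Fin n))
    simp only [Nat.card_eq_fintype_card, Fintype.card_fin, Set.ncard_singleton] at h2 h3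
    omega
  have side : (∃ e, T.Split e i j l m ∧ k ≤ {x | T.Joined e (T.leaf x) (T.leaf l)}.ncard) ∨
      ∃ e, T.Split e l m i j ∧ k ≤ {x | T.Joined e (T.leaf x) (T.leaf i)}.ncard := by
    induction e with | h a b =>
    have hside : ∀ {c z : T.V}, T.Joined s(a, b) c z →
        T.sideLeaves s(a, b) c = {x | T.Joined s(a, b) (T.leaf x) z} := by
      intro c z hcz
      ext x
      simp only [sideLeaves, mem_pathEdges_iff, not_not, Set.mem_ofPred_eq]
      exact ⟨fun h => h.trans hcz, fun h => h.trans hcz.symm⟩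
    have hc : ∀ c, k ≤ (T.sideLeaves s(a, b) c).ncard →
        k ≤ {x | T.Joined s(a, b) (T.leaf x) (T.leaf l)}.ncard ∨
          k ≤ {x | T.Joined s(a, b) (T.leaf x) (T.leaf i)}.ncard := by
      intro c h
      by_cases hci : T.Joined s(a, b) c (T.leaf i)
      · exact Or.inr (hside hci ▸ h)
      · exact Or.inl (hside (he.joined_right hci) ▸ h)
    have := (hps a b (mem_edgeSet_of_not_joined he.2.2)).elim (hc a) (hc b)
    exact this.imp (fun h => ⟨_, he, h⟩) fun h => ⟨_, he.symm, h⟩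
  have flip : (∃ S : Finset (Fin n), S.card = k - 2 ∧ Disjoint S {l, m, i, j} ∧
      ∃ e, T.Split e l m i j ∧ T.Uncut e S ∧ ∀ f, T.Split f l m i j → T.Uncut f S → f = e) →
      ∃ S : Finset (Fin n), S.card = k - 2 ∧ Disjoint S {i, j, l, m} ∧
      ∃ e, T.Split e i j l m ∧ T.Uncut e S ∧
        ∀ f, T.Split f i j l m → T.Uncut f S → f = e := by
    rintro ⟨S, hS, hd, e, he, heS, huniq⟩
    refine ⟨S, hS, ?_, e, he.symm, heS, fun f hf => huniq f hf.symm⟩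
    simp only [Finset.disjoint_insert_right, Finset.disjoint_singleton_right] at hd ⊢
    tauto
  by_cases hβ : ∀ e, T.Split e i j l m → ∃ x, T.Joined e (T.leaf x) (T.leaf l) ∧ x ≠ l ∧ x ≠ m
  · by_cases hα : ∀ e, T.Split e l m i j → ∃ x, T.Joined e (T.leaf x) (T.leaf i) ∧ x ≠ i ∧ x ≠ j
    · rcases side with h | h
      · exact exists_isolating_set_of_le h4 hess hlm hβ h
      · exact flip (exists_isolating_set_of_le h4 hess hij hα h)
    · push Not at hα
      obtain ⟨f, hf, hA⟩ := hα
      exact exists_isolating_set_of_le h4 hess hlm hβ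
        ⟨f, hf.symm, large hf.symm fun x hx => or_iff_not_imp_left.2 (hA x hx)⟩
  · push Not at hβ
    obtain ⟨f, hf, hB⟩ := hβ
    have hB : ∀ x, T.Joined f (T.leaf x) (T.leaf l) → x = l ∨ x = m :=
      fun x hx => or_iff_not_imp_left.2 (hB x hx)
    have hlmc : T.IsCompleteCherry {l, m} :=
      hf.symm.isCompleteCherry hess hlm hij fun x hx => hB x hx.symm
    refine flip (exists_isolating_set_of_le h4 hess hij (fun e he => ?_)
      ⟨f, hf.symm, large hf.symm hB⟩)
    by_contra hA
    push Not at hA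
    exact hc ⟨he.symm.isCompleteCherry hess hij hlm
      fun x hx => or_iff_not_imp_left.2 (hA x hx.symm), hlmc⟩

theorem mem_subtreeEdges_iff {S : Finset (Fin n)} :
    e ∈ T.subtreeEdges ↑S ↔ ¬ T.Uncut e S := by
  simp [subtreeEdges, Uncut, mem_pathEdges_iff]

theorem uncut_insert_insert {S : Finset (Fin n)} {s a b : Fin n} (hs : s ∈ S) :
    T.Uncut e (insert a (insert b S)) ↔
      T.Uncut e S ∧ T.Joined e (T.leaf a) (T.leaf s) ∧ T.Joined e (T.leaf b) (T.leaf s) := by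
  constructor
  · intro h
    refine ⟨fun x hx y hy => h x (by simp [hx]) y (by simp [hy]), ?_, ?_⟩ <;>
      exact h _ (by simp) _ (by simp [hs])
  · rintro ⟨hS, ha, hb⟩
    have : ∀ x ∈ insert a (insert b S), T.Joined e (T.leaf x) (T.leaf s) := by
      intro x hx
      simp only [Finset.mem_insert] at hx
      rcases hx with rfl | rfl | hx
      · exact ha
      · exact hb
      · exact hS x hx s hs
    exact fun x hx y hy => (this x hx).trans (this y hy).symm

open scoped Classical in
/-- The four-point difference of the `k`-weights is supported on the edges that leave the common
part uncut and separate the remaining four leaves two by two. -/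
theorem D_add_D_sub {S : Finset (Fin n)} (hS : S.Nonempty) (i j l m : Fin n) :
    T.D (insert i (insert j S)) + T.D (insert l (insert m S)) -
      (T.D (insert i (insert l S)) + T.D (insert j (insert m S))) =
    ∑ᶠ e, if T.Uncut e S then
      (if T.Split e i j l m then - T.w e else if T.Split e i l j m then T.w e else 0)
      else 0 := by
  have : Fintype T.V := T.fintypeV
  obtain ⟨s, hs⟩ := hS
  have hD : ∀ a b, T.D (insert a (insert b S)) =
      ∑ e, if T.Uncut e S ∧ T.Joined e (T.leaf a) (T.leaf s) ∧
        T.Joined e (T.leaf b) (T.leaf s) then 0 else T.w e := by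
    intro a b
    rw [D, finsum_mem_def, finsum_eq_sum_of_fintype]
    refine Finset.sum_congr rfl fun e _ => ?_
    rw [Set.indicator_apply, mem_subtreeEdges_iff, uncut_insert_insert hs]
    split_ifs <;> rfl
  rw [hD, hD, hD, hD, finsum_eq_sum_of_fintype, ← Finset.sum_add_distrib,
    ← Finset.sum_add_distrib, ← Finset.sum_sub_distrib]
  refine Finset.sum_congr rfl fun e _ => ?_
  by_cases hU : T.Uncut e S
  · have hJ : ∀ a b, T.Joined e (T.leaf a) (T.leaf b) ↔
        (T.Joined e (T.leaf a) (T.leaf s) ↔ T.Joined e (T.leaf b) (T.leaf s)) := by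
      intro a b
      constructor
      · exact fun h => ⟨fun h' => h.symm.trans h', fun h' => h.trans h'⟩
      · intro h
        by_cases ha : T.Joined e (T.leaf a) (T.leaf s)
        · exact ha.trans (h.1 ha).symm
        · exact joined_of_not_joined ha fun h' => ha (h.2 h'.symm)
    simp only [Split, hJ i j, hJ l m, hJ i l, hJ j m]
    by_cases hi : T.Joined e (T.leaf i) (T.leaf s) <;>
      by_cases hj : T.Joined e (T.leaf j) (T.leaf s) <;>
      by_cases hl : T.Joined e (T.leaf l) (T.leaf s) <;>
      by_cases hm : T.Joined e (T.leaf m) (T.leaf s) <;> simp [hU, hi, hj, hl, hm]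
  · simp [hU]

theorem Split.D_add_D_ne (hinz : T.InternalNonzero) (hess : T.Essential) (hij : i ≠ j)
    (hlm : l ≠ m) {S : Finset (Fin n)} (hS : S.Nonempty) (he : T.Split e i j l m)
    (heS : T.Uncut e S) (huniq : ∀ f, T.Split f i j l m → T.Uncut f S → f = e) :
    T.D (insert i (insert j S)) + T.D (insert l (insert m S)) ≠
      T.D (insert i (insert l S)) + T.D (insert j (insert m S)) := by
  rw [← sub_ne_zero, D_add_D_sub hS, finsum_eq_single _ e]
  · simpa [he, heS] using he.ne_zero hinz hess hij hlm
  · intro f hf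
    have h1 : T.Uncut f S → ¬ T.Split f i j l m := fun h h' => hf (huniq f h' h)
    simp +contextual [h1, he.not_split]

theorem exists_split_of_D_add_D_ne {S : Finset (Fin n)} (hS : S.Nonempty)
    (h : T.D (insert i (insert j S)) + T.D (insert l (insert m S)) ≠
      T.D (insert i (insert l S)) + T.D (insert j (insert m S))) :
    ∃ e, T.Split e i j l m ∨ T.Split e i l j m := by
  by_contra! hno
  refine h (sub_eq_zero.1 ?_)
  rw [D_add_D_sub hS]
  simp [hno]

end WTree

/-- if `4 ≤ k ≤ n-2` and `P` is an internal-nonzero-weighted essential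
pseudostar of kind `(n,k)` with leaf set `[n]`, then for distinct leaves `i,j,l,m` the
Buneman index `⟨i,j | l,m⟩` holds iff (a) `{i,j}` and `{l,m}` are complete cherries, or
(b) there are `(k-2)`-subsets `S`, `R` of `[n] - {i,j,l,m}` with
`D_{{i,j}∪S} + D_{{l,m}∪S} ≠ D_{{i,l}∪S} + D_{{j,m}∪S}` and
`D_{{i,j}∪R} + D_{{l,m}∪R} ≠ D_{{i,m}∪R} + D_{{j,l}∪R}`. -/
theorem statement7 (n k : ℕ) (h4 : 4 ≤ k) (hk : k ≤ n - 2)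
    (P : WTree n) (hinz : P.InternalNonzero) (hess : P.Essential)
    (hps : P.IsPseudostar k)
    (i j l m : Fin n) (hcard : ({i, j, l, m} : Finset (Fin n)).card = 4) :
    P.Buneman i j l m ↔
      ((P.IsCompleteCherry {i, j} ∧ P.IsCompleteCherry {l, m}) ∨
        ((∃ S : Finset (Fin n), S.card = k - 2 ∧
            Disjoint S ({i, j, l, m} : Finset (Fin n)) ∧
            P.D (insert i (insert j S)) + P.D (insert l (insert m S)) ≠
              P.D (insert i (insert l S)) + P.D (insert j (insert m S))) ∧
         (∃ R : Finset (Fin n), R.card = k - 2 ∧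
            Disjoint R ({i, j, l, m} : Finset (Fin n)) ∧
            P.D (insert i (insert j R)) + P.D (insert l (insert m R)) ≠
              P.D (insert i (insert m R)) + P.D (insert j (insert l R))))) := by
  have hne : i ≠ j ∧ i ≠ l ∧ i ≠ m ∧ j ≠ l ∧ j ≠ m ∧ l ≠ m := by
    refine ⟨?_, ?_, ?_, ?_, ?_, ?_⟩ <;> rintro rfl <;> revert hcard <;>
      simp only [Finset.insert_comm, Finset.mem_insert, Finset.mem_singleton, true_or, or_true,
        Finset.insert_eq_of_mem] <;>
      exact (lt_of_le_of_lt Finset.card_le_three (by norm_num)).ne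
  obtain ⟨hij, hil, him, hjl, hjm, hlm⟩ := hne
  have hnonempty : ∀ {S : Finset (Fin n)}, S.card = k - 2 → S.Nonempty := fun hS =>
    Finset.card_pos.1 (by omega)
  constructor
  · intro h
    rw [or_iff_not_imp_left]
    intro hc
    obtain ⟨e₀, he₀⟩ := h.exists_split
    obtain ⟨S, hS, hd, e, he, heS, huniq⟩ :=
      WTree.exists_isolating_set h4 hk hess hps hij hlm he₀ hc
    refine ⟨⟨S, hS, hd, he.D_add_D_ne hinz hess hij hlm (hnonempty hS) heS huniq⟩, S, hS, hd, ?_⟩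
    rw [Finset.insert_comm l m]
    exact he.swap_right.D_add_D_ne hinz hess hij hlm.symm (hnonempty hS) heS
      fun f hf => huniq f hf.swap_right
  · rintro (⟨h, h'⟩ | ⟨⟨S, hS, -, hSne⟩, R, hR, -, hRne⟩)
    · exact h.buneman hess hij hil him hjl hjm hlm h'
    · rw [Finset.insert_comm l m] at hRne
      obtain ⟨e, he | he⟩ := WTree.exists_split_of_D_add_D_ne (hnonempty hS) hSne
      · exact he.buneman
      obtain ⟨f, hf | hf⟩ := WTree.exists_split_of_D_add_D_ne (hnonempty hR) hRne
      · exact hf.swap_right.buneman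
      · exact absurd hf.swap_right he.swap_right.not_split
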